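/- arXiv:math/9307217 — 3 statements merged into one kernel-verified Lean document; each statement's English description precedes it below -/
import Mathlib

section
/- Let α, c be complex numbers such that 1−α is not a nonpositive integer. For each integer n ≥ 0 define v_n(x) = ₁F₁(−n−c−α; 1−α; x). Then for every integer n ≥ 1 and every complex x, (2n+2c+α+1−x) v_n(x) = (n+c+1) v_{n+1}(x) + (n+c+α) v_{n−1}(x). -/
/-- Pochhammer symbol `(a)_k` for complex `a`. -/
noncomputable def pochC (a : ℂ) (k : ℕ) : ℂ := (ascPochhammer ℂ k).eval a

/-- Confluent hypergeometric series `₁F₁(a; b; x)`. -/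
noncomputable def hyp1F1 (a b x : ℂ) : ℂ :=
  ∑' k : ℕ, pochC a k * x ^ k / (pochC b k * (Nat.factorial k : ℂ))

/-- The solution `v_n` of the associated Laguerre recurrence. -/
noncomputable def vLag (α c : ℂ) (n : ℕ) (x : ℂ) : ℂ :=
  hyp1F1 (-(n : ℂ) - c - α) (1 - α) x

theorem pochC_succ (a : ℂ) (k : ℕ) : pochC a (k + 1) = pochC a k * (a + k) := by
  simp [pochC, ascPochhammer_succ_eval]

theorem pochC_succ_left (a : ℂ) (k : ℕ) : pochC a (k + 1) = a * pochC (a + 1) k := by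
  simp [pochC, ascPochhammer_succ_left]

theorem pochC_ne (b : ℂ) (hb : ∀ k : ℕ, b ≠ -(k : ℂ)) (k : ℕ) : pochC b k ≠ 0 := by
  induction k with
  | zero => simp [pochC]
  | succ k ih =>
    rw [pochC_succ]
    exact mul_ne_zero ih (fun h => hb k (eq_neg_of_add_eq_zero_left h))

/-- The general term of the series. -/
noncomputable def hterm (a b x : ℂ) (k : ℕ) : ℂ :=
  pochC a k * x ^ k / (pochC b k * (Nat.factorial k : ℂ))

theorem hterm_succ (a b x : ℂ) (hb : ∀ k : ℕ, b ≠ -(k : ℂ)) (k : ℕ) :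
    hterm a b x (k + 1) = ((a + k) / (b + k) * (x * (1 / ((k : ℂ) + 1)))) * hterm a b x k := by
  have h1 := pochC_ne b hb k
  have h2 : b + k ≠ 0 := fun h => hb k (eq_neg_of_add_eq_zero_left h)
  have h3 : (k : ℂ) + 1 ≠ 0 := by exact_mod_cast Nat.succ_ne_zero k
  have h4 : (Nat.factorial k : ℂ) ≠ 0 := by exact_mod_cast Nat.factorial_ne_zero k
  unfold hterm
  rw [pochC_succ, pochC_succ, Nat.factorial_succ]
  push_cast
  field_simp
  ring

theorem hterm_summable (a b x : ℂ) (hb : ∀ k : ℕ, b ≠ -(k : ℂ)) :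
    Summable (hterm a b x) := by
  have ht : Filter.Tendsto (fun k : ℕ => (a + k) / (b + k) * (x * (1 / ((k : ℂ) + 1))))
      Filter.atTop (nhds 0) := by
    have h1 : Filter.Tendsto (fun k : ℕ => (a + k) / (b + k)) Filter.atTop (nhds (1 : ℂ)) := by
      simpa using tendsto_add_mul_div_add_mul_atTop_nhds a b (1 : ℂ) (one_ne_zero : (1 : ℂ) ≠ 0)
    have h2 : Filter.Tendsto (fun k : ℕ => 1 / ((k : ℂ) + 1)) Filter.atTop (nhds (0 : ℂ)) :=
      tendsto_one_div_add_atTop_nhds_zero_nat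
    simpa using h1.mul (h2.const_mul x)
  have ht' := ht.norm
  rw [norm_zero] at ht'
  refine summable_of_ratio_norm_eventually_le (r := 1 / 2) (by norm_num) ?_
  filter_upwards [ht'.eventually (ge_mem_nhds (by norm_num : (0 : ℝ) < 1 / 2))] with k hk
  rw [hterm_succ a b x hb, norm_mul]
  exact mul_le_mul_of_nonneg_right hk (norm_nonneg _)

theorem hterm_contig (a b x : ℂ) (hb : ∀ k : ℕ, b ≠ -(k : ℂ)) (k : ℕ) :
    (b - a) * hterm (a - 1) b x (k + 1) + (2 * a - b) * hterm a b x (k + 1)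
      - a * hterm (a + 1) b x (k + 1) = - x * hterm a b x k := by
  have h1 := pochC_ne b hb k
  have h2 : b + k ≠ 0 := fun h => hb k (eq_neg_of_add_eq_zero_left h)
  have h3 : (k : ℂ) + 1 ≠ 0 := by exact_mod_cast Nat.succ_ne_zero k
  have h4 : (Nat.factorial k : ℂ) ≠ 0 := by exact_mod_cast Nat.factorial_ne_zero k
  have e1 : pochC (a - 1) (k + 1) = (a - 1) * pochC a k := by
    rw [pochC_succ_left, sub_add_cancel]
  have e2 : a * pochC (a + 1) (k + 1) = pochC a k * (a + k) * (a + k + 1) := by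
    rw [← pochC_succ_left, pochC_succ, pochC_succ]; push_cast; ring
  have e3 : a * hterm (a + 1) b x (k + 1) = (a * pochC (a + 1) (k + 1)) * x ^ (k + 1) /
      (pochC b (k + 1) * (Nat.factorial (k + 1) : ℂ)) := by
    unfold hterm; ring
  rw [e3, e2]
  unfold hterm
  rw [e1, pochC_succ, pochC_succ, Nat.factorial_succ]
  push_cast
  field_simp
  ring

theorem hyp_contig (a b x : ℂ) (hb : ∀ k : ℕ, b ≠ -(k : ℂ)) :
    (b - a) * hyp1F1 (a - 1) b x + (2 * a - b) * hyp1F1 a b x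
      - a * hyp1F1 (a + 1) b x = - x * hyp1F1 a b x := by
  have s1 := (hterm_summable (a - 1) b x hb).hasSum.mul_left (b - a)
  have s2 := (hterm_summable a b x hb).hasSum.mul_left (2 * a - b)
  have s3 := (hterm_summable (a + 1) b x hb).hasSum.mul_left a
  have s4 := (hterm_summable a b x hb).hasSum.mul_left (-x)
  have s := (s1.add s2).sub s3
  rw [← hasSum_nat_add_iff' 1] at s
  simp only [hterm_contig a b x hb] at s
  have h := s.unique s4
  have h0 : ∀ a, hterm a b x 0 = 1 := fun a => by simp [hterm, pochC]
  simp only [Finset.sum_range_one, h0] at h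
  have hh : ∀ a, hyp1F1 a b x = ∑' k, hterm a b x k := fun _ => rfl
  simp only [hh]
  linear_combination h

theorem stmt1 (α c : ℂ)
    (hα : ∀ k : ℕ, 1 - α ≠ -(k : ℂ)) :
    ∀ n : ℕ, 1 ≤ n → ∀ x : ℂ,
      (2 * (n : ℂ) + 2 * c + α + 1 - x) * vLag α c n x
        = ((n : ℂ) + c + 1) * vLag α c (n + 1) x
          + ((n : ℂ) + c + α) * vLag α c (n - 1) x := by
  intro n hn x
  have h := hyp_contig (-(n : ℂ) - c - α) (1 - α) x hα
  unfold vLag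
  have e1 : -((n + 1 : ℕ) : ℂ) - c - α = -(n : ℂ) - c - α - 1 := by push_cast; ring
  have e2 : -((n - 1 : ℕ) : ℂ) - c - α = -(n : ℂ) - c - α + 1 := by
    rw [Nat.cast_sub hn]; push_cast; ring
  rw [e1, e2]
  linear_combination -h
end

section
/- Let α, c, μ be real numbers with c > 0, c+α > −1 and c+α ≠ 0, and let L_n^α(x; c, μ) be the co-recursive associated Laguerre polynomials. Then for every real x and every w with 0 < w < 1, ∑_{n=0}^∞ L_n^α(x; c, μ) w^n = w^{−c} (1−w)^{−α−1} exp(−x/(1−w)) · ∫_0^w u^{c−1} (1−u)^{α−1} (c − μu) exp(x/(1−u)) du. -/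
open Filter Topology in
/-- Growth lemma: solutions of the recurrence grow subexponentially. -/
theorem aux_summable (α c x : ℝ) (hc : 0 < c) (a : ℕ → ℝ)
    (hrec : ∀ n : ℕ, ((n : ℝ) + c + 2) * a (n + 2) =
      (2 * (n : ℝ) + 2 * c + α + 3 - x) * a (n + 1) - ((n : ℝ) + 1 + c + α) * a n)
    (w : ℝ) (hw0 : 0 < w) (hw1 : w < 1) : Summable (fun n : ℕ => a n * w ^ n) := by
  obtain ⟨ε, hε, hεw⟩ : ∃ ε : ℝ, 0 < ε ∧ (1 + ε) ^ 2 * w < 1 := by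
    have h : Tendsto (fun ε : ℝ => (1 + ε) ^ 2 * w) (𝓝[>] 0) (𝓝 ((1 + 0) ^ 2 * w)) := by
      apply Tendsto.mono_left _ nhdsWithin_le_nhds
      apply Continuous.tendsto
      fun_prop
    have h2 := h.eventually (gt_mem_nhds (show (1 + 0) ^ 2 * w < 1 by simpa using hw1))
    obtain ⟨ε, h3, h4⟩ := (h2.and self_mem_nhdsWithin).exists
    exact ⟨ε, h4, h3⟩
  set K : ℝ := |α - 1| + |x| with hK
  set V : ℕ → ℝ := fun n => ε * |a (n + 1)| + |a (n + 1) - a n| with hV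
  have hVnn : ∀ n, 0 ≤ V n := fun n => by simp only [hV]; positivity
  have hev : ∀ᶠ n : ℕ in atTop, K / ((n : ℝ) + c + 2) ≤ ε ^ 2 / (1 + ε) := by
    have h1 : Tendsto (fun n : ℕ => (n : ℝ) + c + 2) atTop atTop :=
      tendsto_atTop_add_const_right _ _
        (tendsto_atTop_add_const_right _ _ tendsto_natCast_atTop_atTop)
    have h2 : Tendsto (fun n : ℕ => K / ((n : ℝ) + c + 2)) atTop (𝓝 0) :=
      tendsto_const_nhds.div_atTop h1
    filter_upwards [h2.eventually (gt_mem_nhds (show (0 : ℝ) < ε ^ 2 / (1 + ε) by positivity))]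
      with n hn using hn.le
  have hstep : ∀ᶠ n : ℕ in atTop, V (n + 1) ≤ (1 + ε) ^ 2 * V n := by
    filter_upwards [hev] with n hn
    have hpos : (0 : ℝ) < (n : ℝ) + c + 2 := by positivity
    set t := K / ((n : ℝ) + c + 2) with ht
    have ht0 : 0 ≤ t := by positivity
    have htε : (1 + ε) * t ≤ ε ^ 2 := by
      rw [le_div_iff₀ (by positivity)] at hn
      linarith
    have hd : a (n + 2) - a (n + 1) = (a (n + 1) - a n)
        + ((α - 1) / ((n : ℝ) + c + 2)) * (a (n + 1) - a n)
        - (x / ((n : ℝ) + c + 2)) * a (n + 1) := by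
      field_simp
      linear_combination hrec n
    have hα : |(α - 1) / ((n : ℝ) + c + 2)| ≤ t := by
      rw [abs_div, abs_of_pos hpos, ht]
      gcongr
      rw [hK]; linarith [abs_nonneg x]
    have hx : |x / ((n : ℝ) + c + 2)| ≤ t := by
      rw [abs_div, abs_of_pos hpos, ht]
      gcongr
      rw [hK]; linarith [abs_nonneg (α - 1)]
    set A := |a (n + 1)|
    set D := |a (n + 1) - a n|
    have hA : 0 ≤ A := abs_nonneg _
    have hD : 0 ≤ D := abs_nonneg _
    have hd2 : |a (n + 2) - a (n + 1)| ≤ D + t * D + t * A := by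
      rw [hd]
      refine (abs_sub _ _).trans ?_
      refine (add_le_add_left (abs_add_le _ _) _).trans ?_
      rw [abs_mul, abs_mul]
      gcongr
    have ha2 : |a (n + 2)| ≤ A + |a (n + 2) - a (n + 1)| := by
      have := abs_add_le (a (n + 1)) (a (n + 2) - a (n + 1))
      simpa using this
    show ε * |a (n + 2)| + |a (n + 2) - a (n + 1)| ≤ (1 + ε) ^ 2 * (ε * A + D)
    have e1 : ε * |a (n + 2)| ≤ ε * (A + |a (n + 2) - a (n + 1)|) := by gcongr
    have e2 : (1 + ε) * |a (n + 2) - a (n + 1)| ≤ (1 + ε) * (D + t * D + t * A) := by gcongr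
    have e3 : (1 + ε) * t * D ≤ ε ^ 2 * D := by gcongr
    have e4 : (1 + ε) * t * A ≤ ε ^ 2 * A := by gcongr
    have e5 : 0 ≤ ε * D := by positivity
    have e6 : 0 ≤ ε ^ 2 * A := by positivity
    have e7 : 0 ≤ ε ^ 3 * A := by positivity
    nlinarith
  have hVs : Summable (fun n => V n * w ^ n) := by
    refine summable_of_ratio_norm_eventually_le hεw ?_
    filter_upwards [hstep] with n hn
    rw [Real.norm_of_nonneg (mul_nonneg (hVnn _) (by positivity)),
      Real.norm_of_nonneg (mul_nonneg (hVnn _) (by positivity)), pow_succ]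
    have := mul_le_mul_of_nonneg_right hn (show 0 ≤ w ^ n * w by positivity)
    linarith
  rw [← summable_nat_add_iff 1]
  refine Summable.of_norm_bounded (hVs.mul_left (w / ε)) ?_
  intro n
  rw [norm_mul, Real.norm_eq_abs, Real.norm_of_nonneg (by positivity), pow_succ]
  have h1 : ε * |a (n + 1)| ≤ V n := by
    simp only [hV]; linarith [abs_nonneg (a (n + 1) - a n)]
  have h2 : |a (n + 1)| ≤ V n / ε := by
    rw [le_div_iff₀ hε]; linarith
  calc |a (n + 1)| * (w ^ n * w) ≤ V n / ε * (w ^ n * w) := by gcongr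
    _ = w / ε * (V n * w ^ n) := by ring

open Filter Topology in
theorem aux_summable' (a : ℕ → ℝ)
    (hs : ∀ w : ℝ, 0 < w → w < 1 → Summable (fun n : ℕ => a n * w ^ n))
    (w : ℝ) (hw0 : 0 < w) (hw1 : w < 1) : Summable (fun n : ℕ => (n : ℝ) * a n * w ^ n) := by
  obtain ⟨s, hws, hs1⟩ := exists_between hw1
  have hs0 : 0 < s := hw0.trans hws
  obtain ⟨C, hC⟩ := (hs s hs0 hs1).tendsto_atTop_zero.norm.bddAbove_range
  have hr : ‖w / s‖ < 1 := by
    rw [Real.norm_of_nonneg (by positivity), div_lt_one hs0]; exact hws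
  have h1 := (summable_pow_mul_geometric_of_norm_lt_one 1 hr).mul_left C
  refine Summable.of_norm_bounded h1 ?_
  intro n
  have hCn : ‖a n * s ^ n‖ ≤ C := hC ⟨n, rfl⟩
  have : (n : ℝ) * a n * w ^ n = (a n * s ^ n) * ((n : ℝ) ^ 1 * (w / s) ^ n) := by
    rw [div_pow]; field_simp
  rw [this, norm_mul, Real.norm_of_nonneg (show 0 ≤ (n : ℝ) ^ 1 * (w / s) ^ n by positivity)]
  gcongr

theorem aux_deriv (a : ℕ → ℝ)
    (hs : ∀ w : ℝ, 0 < w → w < 1 → Summable (fun n : ℕ => a n * w ^ n))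
    (w : ℝ) (hw0 : -1 < w) (hw1 : w < 1) :
    HasDerivAt (fun w => ∑' n : ℕ, a n * w ^ n) (∑' n : ℕ, a n * ((n : ℝ) * w ^ (n - 1))) w := by
  obtain ⟨s, hws, hs1⟩ := exists_between (abs_lt.2 ⟨hw0, hw1⟩)
  have hs0 : 0 < s := (abs_nonneg w).trans_lt hws
  have hu : Summable (fun n : ℕ => |a n| * ((n : ℝ) * s ^ (n - 1))) := by
    have := ((aux_summable' a hs s hs0 hs1).norm).mul_left s⁻¹
    refine this.congr ?_
    intro n
    rw [norm_mul, norm_mul, Real.norm_of_nonneg (by positivity : 0 ≤ s ^ n)]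
    rcases n with _ | n
    · simp
    · simp only [Real.norm_eq_abs, Nat.abs_cast, pow_succ, Nat.add_sub_cancel]
      field_simp
  refine hasDerivAt_tsum_of_isPreconnected (t := Set.Ioo (-s) s) (y₀ := 0) hu isOpen_Ioo
    isPreconnected_Ioo (fun n y _ => (hasDerivAt_pow n y).const_mul (a n)) ?_ ?_ ?_ ?_
  · intro n y hy
    rw [norm_mul, norm_mul, norm_pow, Real.norm_eq_abs, Real.norm_eq_abs, Real.norm_eq_abs,
      Nat.abs_cast]
    have : |y| ≤ s := (abs_lt.2 hy).le
    gcongr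
  · exact ⟨by linarith, hs0⟩
  · refine summable_of_ne_finset_zero (s := {0}) ?_
    intro n hn
    have : n ≠ 0 := by simpa using hn
    simp [this]
  · exact abs_lt.1 hws

theorem stmt6 (α c μ : ℝ) (hc : 0 < c) (hca : -1 < c + α) (hca0 : c + α ≠ 0)
    (L : ℤ → ℝ → ℝ)
    (hinitm : ∀ x : ℝ, L (-1) x = μ / (c + α))
    (hinit0 : ∀ x : ℝ, L 0 x = 1)
    (hrec : ∀ n : ℕ, ∀ x : ℝ,
      (2 * (n : ℝ) + 2 * c + α + 1 - x) * L (n : ℤ) x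
        = ((n : ℝ) + c + 1) * L ((n : ℤ) + 1) x + ((n : ℝ) + c + α) * L ((n : ℤ) - 1) x) :
    ∀ x : ℝ, ∀ w : ℝ, 0 < w → w < 1 →
      (∑' n : ℕ, L (n : ℤ) x * w ^ n)
        = w ^ (-c) * (1 - w) ^ (-α - 1) * Real.exp (-x / (1 - w)) *
          ∫ u in (0 : ℝ)..w,
            u ^ (c - 1) * (1 - u) ^ (α - 1) * (c - μ * u) * Real.exp (x / (1 - u)) := by
  intro x w hw0 hw1
  set a : ℕ → ℝ := fun n => L (n : ℤ) x with ha
  have ha0 : a 0 = 1 := by simp [ha, hinit0]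
  have ha1 : (c + 1) * a 1 = (2 * c + α + 1 - x) - μ := by
    have h := hrec 0 x
    simp only [Nat.cast_zero, zero_add, zero_sub, hinit0, hinitm, mul_zero, mul_one] at h
    have h2 : (c + α) * (μ / (c + α)) = μ := by field_simp
    have h3 : a 1 = L 1 x := by simp [ha]
    rw [h3]; linarith
  have har : ∀ n : ℕ, ((n : ℝ) + c + 2) * a (n + 2) =
      (2 * (n : ℝ) + 2 * c + α + 3 - x) * a (n + 1) - ((n : ℝ) + 1 + c + α) * a n := by
    intro n
    have h := hrec (n + 1) x
    have h1 : (((n + 1 : ℕ) : ℤ) + 1) = ((n + 2 : ℕ) : ℤ) := by push_cast; ring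
    have h2 : (((n + 1 : ℕ) : ℤ) - 1) = (n : ℤ) := by push_cast; ring
    rw [h1, h2] at h
    simp only [ha]
    push_cast at h ⊢
    linear_combination -h
  have hs := fun w h0 h1 => aux_summable α c x hc a har w h0 h1
  have hs' := aux_summable' a hs
  set F : ℝ → ℝ := fun w => ∑' n : ℕ, a n * w ^ n with hF
  -- the differential equation
  have hode : ∀ u : ℝ, 0 < u → u < 1 → ∃ F' : ℝ, HasDerivAt F F' u ∧
      (1 - u) ^ 2 * (u * F' + c * F u) =
        c - μ * u + (u * (α + 1) * (1 - u) - x * u) * F u := by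
    intro u hu0 hu1
    refine ⟨_, aux_deriv a hs u (by linarith) hu1, ?_⟩
    have s0 := hs u hu0 hu1
    have s1 := hs' u hu0 hu1
    have hF'eq : u * (∑' n : ℕ, a n * ((n : ℝ) * u ^ (n - 1)))
        = ∑' n : ℕ, (n : ℝ) * a n * u ^ n := by
      rw [← tsum_mul_left]
      congr 1; ext n
      rcases n with _ | n
      · simp
      · rw [Nat.add_sub_cancel, pow_succ]; ring
    rw [hF'eq]
    have hS0 : HasSum (fun n : ℕ => a n * u ^ n) (F u) := s0.hasSum
    set S1 := ∑' n : ℕ, (n : ℝ) * a n * u ^ n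
    have hS1 : HasSum (fun n : ℕ => (n : ℝ) * a n * u ^ n) S1 := s1.hasSum
    have hS0' : HasSum (fun n : ℕ => a (n + 1) * u ^ (n + 1)) (F u - 1) := by
      have := (hasSum_nat_add_iff' (f := fun n : ℕ => a n * u ^ n) 1).2 hS0
      simpa [ha0] using this
    have hS1' : HasSum (fun n : ℕ => ((n + 1 : ℕ) : ℝ) * a (n + 1) * u ^ (n + 1)) S1 := by
      have := (hasSum_nat_add_iff' (f := fun n : ℕ => (n : ℝ) * a n * u ^ n) 1).2 hS1
      simpa using this
    have hS0'' : HasSum (fun n : ℕ => a (n + 2) * u ^ (n + 2)) (F u - (1 + a 1 * u)) := by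
      have := (hasSum_nat_add_iff' (f := fun n : ℕ => a n * u ^ n) 2).2 hS0
      simpa [ha0, Finset.sum_range_succ] using this
    have hS1'' : HasSum (fun n : ℕ => ((n + 2 : ℕ) : ℝ) * a (n + 2) * u ^ (n + 2))
        (S1 - a 1 * u) := by
      have := (hasSum_nat_add_iff' (f := fun n : ℕ => (n : ℝ) * a n * u ^ n) 2).2 hS1
      simpa [Finset.sum_range_succ] using this
    have hL := hS1''.add (hS0''.mul_left c)
    have hR := (((hS1'.mul_left (2 * u)).add (hS0'.mul_left (u * (2 * c + α + 1 - x)))).sub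
      (hS1.mul_left (u ^ 2))).sub (hS0.mul_left (u ^ 2 * (1 + c + α)))
    have hR' := hL
    rw [show (fun b : ℕ => ((b + 2 : ℕ) : ℝ) * a (b + 2) * u ^ (b + 2)
        + c * (a (b + 2) * u ^ (b + 2))) = _ from funext (fun n => by
      show _ = 2 * u * (((n + 1 : ℕ) : ℝ) * a (n + 1) * u ^ (n + 1)) +
        u * (2 * c + α + 1 - x) * (a (n + 1) * u ^ (n + 1)) - u ^ 2 * ((n : ℝ) * a n * u ^ n) -
        u ^ 2 * (1 + c + α) * (a n * u ^ n)
      push_cast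
      linear_combination (u ^ (n + 2)) * har n)] at hR'
    have heq := hR'.unique hR
    linear_combination heq + u * ha1
  set G : ℝ → ℝ := fun u => u ^ c * (1 - u) ^ (α + 1) * Real.exp (x / (1 - u)) * F u with hG
  have hFc : ∀ u ∈ Set.Icc 0 w, ContinuousAt F u := fun u hu =>
    (aux_deriv a hs u (by linarith [hu.1]) (by linarith [hu.2])).continuousAt
  have hGc : ContinuousOn G (Set.Icc 0 w) := by
    intro u hu
    have h1 : 1 - u ≠ 0 := by linarith [hu.2]
    apply ContinuousAt.continuousWithinAt
    refine ContinuousAt.mul (ContinuousAt.mul (ContinuousAt.mul ?_ ?_) ?_) (hFc u hu)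
    · exact Real.continuousAt_rpow_const _ _ (Or.inr hc.le)
    · exact ContinuousAt.rpow_const (by fun_prop) (Or.inl h1)
    · exact (ContinuousAt.div (by fun_prop) (by fun_prop) h1).rexp
  have hGd : ∀ u ∈ Set.Ioo 0 w, HasDerivAt G
      (u ^ (c - 1) * (1 - u) ^ (α - 1) * (c - μ * u) * Real.exp (x / (1 - u))) u := by
    intro u hu
    have hu0 : 0 < u := hu.1
    have hu1 : 0 < 1 - u := by linarith [hu.2]
    obtain ⟨F', hF', ho⟩ := hode u hu0 (by linarith)
    have d1 : HasDerivAt (fun u : ℝ => u ^ c) (c * u ^ (c - 1)) u :=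
      Real.hasDerivAt_rpow_const (Or.inl hu0.ne')
    have d0 : HasDerivAt (fun u : ℝ => 1 - u) (-1) u := by
      simpa using (hasDerivAt_id u).const_sub 1
    have d2 := d0.rpow_const (p := α + 1) (Or.inl hu1.ne')
    have d3 := (((hasDerivAt_const u x).div d0 hu1.ne')).exp
    have := ((d1.mul d2).mul d3).mul hF'
    refine HasDerivAt.congr_deriv this ?_
    have r1 : u ^ c = u ^ (c - 1) * u := by
      rw [← Real.rpow_add_one hu0.ne']; congr 1; ring
    have r2 : (1 - u) ^ (α + 1) = (1 - u) ^ (α - 1) * (1 - u) ^ 2 := by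
      rw [← Real.rpow_natCast, ← Real.rpow_add hu1]; congr 1; push_cast; ring
    have r3 : (1 - u) ^ (α + 1 - 1) = (1 - u) ^ (α - 1) * (1 - u) := by
      rw [← Real.rpow_add_one hu1.ne']; congr 1; ring
    simp only [Pi.mul_apply, Pi.div_apply, r1, r2, r3]
    set E := Real.exp (x / (1 - u))
    set P := u ^ (c - 1)
    set Q := (1 - u) ^ (α - 1)
    have hne := hu1.ne'
    field_simp
    linear_combination (P * Q * E) * ho
  have hint : IntervalIntegrable (fun u : ℝ => u ^ (c - 1) * (1 - u) ^ (α - 1) * (c - μ * u) *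
      Real.exp (x / (1 - u))) MeasureTheory.volume 0 w := by
    have h1 : IntervalIntegrable (fun u : ℝ => u ^ (c - 1)) MeasureTheory.volume 0 w :=
      intervalIntegral.intervalIntegrable_rpow' (by linarith)
    have h2 : ContinuousOn (fun u : ℝ => (1 - u) ^ (α - 1) * (c - μ * u) *
      Real.exp (x / (1 - u))) (Set.uIcc 0 w) := by
      rw [Set.uIcc_of_le hw0.le]
      intro u hu
      have h1 : 1 - u ≠ 0 := by linarith [hu.2]
      apply ContinuousAt.continuousWithinAt
      refine ContinuousAt.mul (ContinuousAt.mul ?_ (by fun_prop)) ?_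
      · exact ContinuousAt.rpow_const (by fun_prop) (Or.inl h1)
      · exact (ContinuousAt.div (by fun_prop) (by fun_prop) h1).rexp
    refine (h1.mul_continuousOn h2).congr ?_
    intro u _
    simp only [mul_assoc]
  rw [intervalIntegral.integral_eq_sub_of_hasDerivAt_of_le hw0.le hGc hGd hint]
  have hG0 : G 0 = 0 := by simp [hG, Real.zero_rpow hc.ne']
  rw [hG0, sub_zero]
  have hw2 : 0 < 1 - w := by linarith
  have k1 : w ^ (-c) * w ^ c = 1 := by rw [← Real.rpow_add hw0]; simp
  have k2 : (1 - w) ^ (-α - 1) * (1 - w) ^ (α + 1) = 1 := by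
    rw [← Real.rpow_add hw2]
    rw [show -α - 1 + (α + 1) = 0 by ring, Real.rpow_zero]
  have k3 : Real.exp (-x / (1 - w)) * Real.exp (x / (1 - w)) = 1 := by
    rw [← Real.exp_add, neg_div]; simp
  show F w = _
  calc F w = (w ^ (-c) * w ^ c) * ((1 - w) ^ (-α - 1) * (1 - w) ^ (α + 1)) *
        (Real.exp (-x / (1 - w)) * Real.exp (x / (1 - w))) * F w := by rw [k1, k2, k3]; ring
    _ = _ := by simp only [hG]; ring
end

section
/- Let α, c be real numbers with c > 0, c+α ≠ 0, and c, c+α not nonpositive integers. The zero-related Laguerre polynomials are the CAL polynomials with μ = c. Then for every n ≥ 0 and every x, L_n^α(x; c, c) = ((c+α+1)_n / n!) · ∑_{k=0}^n [ (−n)_k / ((c+1)_k (c+α+1)_k) ] · ( ∑_{j=0}^{n−k} [ (k−n)_j (c)_j (c+α+1)_j ] / [ (c+k+1)_j (c+α+k+1)_j j! ] ) · x^k. -/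
/-- Pochhammer symbol `(a)_k` for real `a`. -/
noncomputable def pochR (a : ℝ) (k : ℕ) : ℝ := (ascPochhammer ℝ k).eval a

theorem pochR_zero (a : ℝ) : pochR a 0 = 1 := by simp [pochR]

theorem pochR_succ (a : ℝ) (k : ℕ) : pochR a (k + 1) = pochR a k * (a + k) := by
  simp [pochR, ascPochhammer_succ_eval]

theorem pochR_left (a : ℝ) (k : ℕ) : pochR a (k + 1) = a * pochR (a + 1) k := by
  induction k with
  | zero => simp [pochR_zero, pochR_succ]
  | succ k ih =>
    rw [pochR_succ, ih, pochR_succ (a + 1)]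
    push_cast
    ring

theorem pochR_add (a : ℝ) (k j : ℕ) : pochR a (k + j) = pochR a k * pochR (a + k) j := by
  induction j with
  | zero => simp [pochR_zero]
  | succ j ih =>
    rw [← add_assoc, pochR_succ, ih, pochR_succ (a + k)]
    push_cast
    ring

theorem pochR_ne (a : ℝ) (h : ∀ k : ℕ, a + k ≠ 0) (k : ℕ) : pochR a k ≠ 0 := by
  induction k with
  | zero => simp [pochR_zero]
  | succ k ih => rw [pochR_succ]; exact mul_ne_zero ih (h k)

theorem pochR_neg (n : ℕ) (m : ℕ) (h : n < m) : pochR (-(n : ℝ)) m = 0 := by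
  obtain ⟨d, rfl⟩ := Nat.exists_eq_add_of_lt h
  rw [add_assoc, add_comm d 1, ← add_assoc, pochR_add, pochR_succ]
  simp

noncomputable def zU (c β : ℝ) (n m : ℕ) : ℝ :=
  pochR β n / (n.factorial : ℝ) * (pochR (-(n : ℝ)) m / (pochR (c + 1) m * pochR β m))

noncomputable def zD (c β : ℝ) (m : ℕ) : ℝ := pochR c m * pochR β m / (m.factorial : ℝ)

noncomputable def zS (c β x : ℝ) (m : ℕ) : ℝ :=
  ∑ k ∈ Finset.range (m + 1), zD c β (m - k) * x ^ k

noncomputable def zP (c β x : ℝ) (n : ℕ) : ℝ :=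
  ∑ m ∈ Finset.range (n + 1), zU c β n m * zS c β x m

theorem zS_zero (c β x : ℝ) : zS c β x 0 = 1 := by
  simp [zS, zD, pochR_zero]

theorem zS_succ (c β x : ℝ) (m : ℕ) : zS c β x (m + 1) = x * zS c β x m + zD c β (m + 1) := by
  unfold zS
  rw [Finset.sum_range_succ', Finset.mul_sum]
  simp only [pow_zero, mul_one, Nat.sub_zero, Nat.add_sub_add_right]
  congr 1
  apply Finset.sum_congr rfl
  intros
  ring

theorem zU_zero (c β : ℝ) (n m : ℕ) (h : n < m) : zU c β n m = 0 := by
  simp [zU, pochR_neg n m h]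

theorem zP_ext (c β x : ℝ) (n N : ℕ) (h : n ≤ N) :
    zP c β x n = ∑ m ∈ Finset.range (N + 1), zU c β n m * zS c β x m := by
  unfold zP
  apply Finset.sum_subset
  · intro i hi
    simp only [Finset.mem_range] at *
    omega
  · intro i _ hi
    simp only [Finset.mem_range] at *
    rw [zU_zero _ _ _ _ (by omega), zero_mul]

theorem zU_rec (c β : ℝ) (hc : ∀ k : ℕ, c + 1 + k ≠ 0) (hβ : ∀ k : ℕ, β + k ≠ 0) (n m : ℕ) :
    (2 * ((n : ℝ) + 1) + β + c) * zU c β (n + 1) (m + 1)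
      - ((n : ℝ) + c + 2) * zU c β (n + 2) (m + 1) - ((n : ℝ) + β) * zU c β n (m + 1)
      = zU c β (n + 1) m := by
  have hn : (n : ℝ) + 1 ≠ 0 := by positivity
  have hn2 : (n : ℝ) + 2 ≠ 0 := by positivity
  have hf : (n.factorial : ℝ) ≠ 0 := by positivity
  have h1 := pochR_ne _ hc m
  have h2 := pochR_ne _ hβ m
  have h3 := hc m
  have h4 := hβ m
  have e0 : pochR (-((n + 2 : ℕ) : ℝ)) (m + 1) = -((n : ℝ) + 2) * pochR (-((n : ℝ) + 1)) m := by
    rw [pochR_left]; push_cast; congr 2 <;> ring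
  have e1 : pochR (-(n : ℝ)) (m + 1) =
      pochR (-((n : ℝ) + 1)) m * (-((n : ℝ) + 1) + m) * (-((n : ℝ) + 1) + m + 1)
        / (-((n : ℝ) + 1)) := by
    rw [eq_div_iff (neg_ne_zero.mpr hn)]
    have := pochR_left (-((n : ℝ) + 1)) (m + 1)
    rw [pochR_succ, pochR_succ] at this
    rw [show -((n : ℝ) + 1) + 1 = -(n : ℝ) by ring] at this
    push_cast at this
    linarith
  have e2 : pochR (-((n + 1 : ℕ) : ℝ)) (m + 1)
      = pochR (-((n : ℝ) + 1)) m * (-((n : ℝ) + 1) + m) := by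
    rw [pochR_succ]; push_cast; rfl
  have e3 : pochR (-((n + 1 : ℕ) : ℝ)) m = pochR (-((n : ℝ) + 1)) m := by
    push_cast; rfl
  unfold zU
  rw [e0, e1, e2, e3]
  simp only [pochR_succ, Nat.factorial_succ]
  generalize pochR (-((n : ℝ) + 1)) m = q
  generalize pochR (c + 1) m = A at *
  generalize pochR β m = B at *
  push_cast
  have hn2' : (n : ℝ) + 1 + 1 ≠ 0 := by positivity
  field_simp
  ring

theorem zU_rec0 (c β : ℝ) (n : ℕ) :
    (2 * ((n : ℝ) + 1) + β + c) * zU c β (n + 1) 0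
      - ((n : ℝ) + c + 2) * zU c β (n + 2) 0 - ((n : ℝ) + β) * zU c β n 0
      = c * (pochR β (n + 1) / ((n + 1).factorial : ℝ)) * (1 - β) / ((n : ℝ) + 2) := by
  have hf : (n.factorial : ℝ) ≠ 0 := by positivity
  unfold zU
  simp only [pochR_succ, pochR_zero, Nat.factorial_succ]
  push_cast
  have hn2' : (n : ℝ) + 1 + 1 ≠ 0 := by positivity
  field_simp
  ring

theorem z_tel (a β : ℝ) (M : ℕ) :
    a * (a - 1) * ∑ m ∈ Finset.range M, pochR a m * (β + m) / ((m + 1).factorial : ℝ)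
      = a * (β - 1) * (pochR a M / (M.factorial : ℝ) - 1)
        + (a - 1) * M * (pochR a M / (M.factorial : ℝ)) := by
  induction M with
  | zero => simp [pochR_zero]
  | succ M ih =>
    have hf : (M.factorial : ℝ) ≠ 0 := by positivity
    rw [Finset.sum_range_succ, mul_add, ih, pochR_succ]
    simp only [Nat.factorial_succ]
    push_cast
    field_simp
    ring

theorem z_sum (c β : ℝ) (hc : ∀ k : ℕ, c + 1 + k ≠ 0) (hβ : ∀ k : ℕ, β + k ≠ 0) (n : ℕ) :
    ∑ m ∈ Finset.range (n + 2), zU c β (n + 1) m * zD c β (m + 1)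
      = c * (pochR β (n + 1) / ((n + 1).factorial : ℝ)) * (β - 1) / ((n : ℝ) + 2) := by
  have hn : (n : ℝ) + 1 ≠ 0 := by positivity
  have hn2 : (n : ℝ) + 2 ≠ 0 := by positivity
  have key := z_tel (-((n + 1 : ℕ) : ℝ)) β (n + 2)
  rw [pochR_neg (n + 1) (n + 2) (by omega)] at key
  have e : ∀ m ∈ Finset.range (n + 2), zU c β (n + 1) m * zD c β (m + 1)
      = c * (pochR β (n + 1) / ((n + 1).factorial : ℝ)) *
        (pochR (-((n + 1 : ℕ) : ℝ)) m * (β + m) / ((m + 1).factorial : ℝ)) := by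
    intro m _
    have h1 := pochR_ne _ hc m
    have h2 := pochR_ne _ hβ m
    unfold zU zD
    rw [pochR_left c, pochR_succ β m]
    field_simp
  rw [Finset.sum_congr rfl e, ← Finset.mul_sum, mul_div_assoc]
  congr 1
  rw [eq_div_iff hn2]
  push_cast at key ⊢
  apply mul_left_cancel₀ hn
  linear_combination key

theorem zP_rec (c β x : ℝ) (hc : ∀ k : ℕ, c + 1 + k ≠ 0) (hβ : ∀ k : ℕ, β + k ≠ 0) (n : ℕ) :
    (2 * ((n : ℝ) + 1) + β + c - x) * zP c β x (n + 1)
      = ((n : ℝ) + c + 2) * zP c β x (n + 2) + ((n : ℝ) + β) * zP c β x n := by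
  have h1 : (2 * ((n : ℝ) + 1) + β + c) * zP c β x (n + 1)
      - ((n : ℝ) + c + 2) * zP c β x (n + 2) - ((n : ℝ) + β) * zP c β x n
      = ∑ m ∈ Finset.range (n + 2 + 1), ((2 * ((n : ℝ) + 1) + β + c) * zU c β (n + 1) m
      - ((n : ℝ) + c + 2) * zU c β (n + 2) m - ((n : ℝ) + β) * zU c β n m) * zS c β x m := by
    rw [zP_ext c β x (n + 1) (n + 2) (by omega), zP_ext c β x n (n + 2) (by omega),
      zP_ext c β x (n + 2) (n + 2) le_rfl, Finset.mul_sum, Finset.mul_sum, Finset.mul_sum,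
      ← Finset.sum_sub_distrib, ← Finset.sum_sub_distrib]
    apply Finset.sum_congr rfl
    intros
    ring
  rw [Finset.sum_range_succ', zU_rec0, zS_zero] at h1
  have h2 : ∑ m ∈ Finset.range (n + 2), ((2 * ((n : ℝ) + 1) + β + c) * zU c β (n + 1) (m + 1)
      - ((n : ℝ) + c + 2) * zU c β (n + 2) (m + 1) - ((n : ℝ) + β) * zU c β n (m + 1))
        * zS c β x (m + 1)
      = x * zP c β x (n + 1)
        + ∑ m ∈ Finset.range (n + 2), zU c β (n + 1) m * zD c β (m + 1) := by
    unfold zP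
    rw [Finset.mul_sum, ← Finset.sum_add_distrib]
    apply Finset.sum_congr rfl
    intro m _
    rw [zU_rec c β hc hβ, zS_succ]
    ring
  rw [h2, z_sum c β hc hβ] at h1
  linear_combination h1

theorem zP_eq (c β x : ℝ) (n : ℕ) :
    zP c β x n = pochR β n / (Nat.factorial n : ℝ) *
        ∑ k ∈ Finset.range (n + 1),
          pochR (-(n : ℝ)) k / (pochR (c + 1) k * pochR β k) *
            (∑ j ∈ Finset.range (n - k + 1),
              pochR ((k : ℝ) - (n : ℝ)) j * pochR c j * pochR β j /
                (pochR (c + (k : ℝ) + 1) j * pochR (β + (k : ℝ)) j *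
                  (Nat.factorial j : ℝ))) *
            x ^ k := by
  have h : zP c β x n = ∑ m ∈ Finset.range (n + 1), ∑ k ∈ Finset.range (m + 1),
      (fun k j => zU c β n (k + j) * (zD c β j * x ^ k)) k (m - k) := by
    unfold zP zS
    apply Finset.sum_congr rfl
    intro m _
    rw [Finset.mul_sum]
    apply Finset.sum_congr rfl
    intro k hk
    have : k + (m - k) = m := by
      have := Finset.mem_range.mp hk
      omega
    simp only [this]
  rw [h, Finset.sum_range_diag_flip (n + 1) (fun k j => zU c β n (k + j) * (zD c β j * x ^ k)),
    Finset.mul_sum]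
  apply Finset.sum_congr rfl
  intro k hk
  have : n + 1 - k = n - k + 1 := by
    have := Finset.mem_range.mp hk
    omega
  rw [this, Finset.mul_sum, Finset.sum_mul, Finset.mul_sum]
  apply Finset.sum_congr rfl
  intro j _
  simp only [zU, zD, pochR_add]
  rw [show -(n : ℝ) + k = (k : ℝ) - n by ring, show c + 1 + (k : ℝ) = c + k + 1 by ring]
  simp only [div_eq_mul_inv, mul_inv]
  ring

theorem stmt12 (α c : ℝ) (hc : 0 < c) (hca : c + α ≠ 0)
    (hcz : ∀ k : ℕ, c ≠ -(k : ℝ))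
    (hcαz : ∀ k : ℕ, c + α ≠ -(k : ℝ))
    (L : ℤ → ℝ → ℝ)
    (hinitm : ∀ x : ℝ, L (-1) x = c / (c + α))
    (hinit0 : ∀ x : ℝ, L 0 x = 1)
    (hrec : ∀ n : ℕ, ∀ x : ℝ,
      (2 * (n : ℝ) + 2 * c + α + 1 - x) * L (n : ℤ) x
        = ((n : ℝ) + c + 1) * L ((n : ℤ) + 1) x + ((n : ℝ) + c + α) * L ((n : ℤ) - 1) x) :
    ∀ n : ℕ, ∀ x : ℝ,
      L (n : ℤ) x = pochR (c + α + 1) n / (Nat.factorial n : ℝ) *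
        ∑ k ∈ Finset.range (n + 1),
          pochR (-(n : ℝ)) k / (pochR (c + 1) k * pochR (c + α + 1) k) *
            (∑ j ∈ Finset.range (n - k + 1),
              pochR ((k : ℝ) - (n : ℝ)) j * pochR c j * pochR (c + α + 1) j /
                (pochR (c + (k : ℝ) + 1) j * pochR (c + α + (k : ℝ) + 1) j *
                  (Nat.factorial j : ℝ))) *
            x ^ k := by
  
  intro n x
  have hc' : ∀ k : ℕ, c + 1 + k ≠ 0 := fun k => by positivity
  have hβ : ∀ k : ℕ, c + α + 1 + k ≠ 0 := by
    intro k h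
    apply hcαz (k + 1)
    push_cast
    linarith
  have main : ∀ n : ℕ, L (n : ℤ) x = zP c (c + α + 1) x n
      ∧ L ((n + 1 : ℕ) : ℤ) x = zP c (c + α + 1) x (n + 1) := by
    intro n
    induction n with
    | zero =>
      constructor
      · simp [hinit0, zP, zU, zS_zero, pochR_zero]
      · have h := hrec 0 x
        simp only [Nat.cast_zero, zero_add, zero_sub, hinitm, hinit0] at h
        have hc1 : c + 1 ≠ 0 := by positivity
        have hb := hβ 0
        simp only [Nat.cast_zero, add_zero] at hb
        have h0 : (c + α) * (c / (c + α)) = c := by field_simp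
        rw [h0] at h
        have : L 1 x = (c + α + 1 - x) / (c + 1) := by
          rw [eq_div_iff hc1]
          linarith
        simp only [zero_add, Nat.cast_one, this]
        simp [zP, zU, Finset.sum_range_succ, zS_zero, zS_succ, zD, pochR_zero, pochR_succ]
        field_simp
        ring
    | succ n ih =>
      refine ⟨ih.2, ?_⟩
      have h := hrec (n + 1) x
      have h2 := zP_rec c (c + α + 1) x hc' hβ n
      rw [show ((n + 1 : ℕ) : ℤ) - 1 = (n : ℤ) by push_cast; ring,
        show ((n + 1 : ℕ) : ℤ) + 1 = ((n + 1 + 1 : ℕ) : ℤ) by push_cast; ring, ih.1, ih.2] at h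
      have hne : (n : ℝ) + c + 2 ≠ 0 := by positivity
      apply mul_left_cancel₀ hne
      push_cast at h h2 ⊢
      linear_combination h2 - h
  rw [(main n).1, zP_eq]
  simp only [show ∀ k : ℕ, c + α + 1 + (k : ℝ) = c + α + k + 1 from fun k => by ring]
end
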